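/- arXiv:2110.10735 — 4 statements merged into one kernel-verified Lean document; each statement's English description precedes it below -/
import Mathlib

section
/- Let Z and S be finite types, let p be a strictly positive probability mass function on Z × S with marginals p_Z(z) = ∑_s p(z,s) and p_S(s) = ∑_z p(z,s), and let q : Z → S → ℝ be strictly positive with ∑_s q(s|z) = 1 for every z. Then I(Z;S) = ∑_{z,s} p(z,s) · log q(s|z) + H(S) + ∑_z p_Z(z) · KL(p(·|z) ‖ q(·|z)), where p(s|z) = p(z,s)/p_Z(z), H(S) = −∑_s p_S(s) log p_S(s), and KL(p(·|z) ‖ q(·|z)) = ∑_s p(s|z) log(p(s|z)/q(s|z)). Consequently, I(Z;S) ≥ ∑_{z,s} p(z,s) · log q(s|z) + H(S), i.e., the mutual information is lower-bounded by the predictive objective I_pred plus the entropy of S. -/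
open Finset

/-- The predictive lower bound on mutual information:
`I(Z;S) = I_pred + H(S) + E_z KL(p(·|z) ‖ q(·|z))`, hence `I(Z;S) ≥ I_pred + H(S)`. -/
theorem mutual_info_predictive_lower_bound
    {Z S : Type*} [Fintype Z] [Fintype S]
    (p : Z × S → ℝ) (hp : ∀ x, 0 < p x) (hpsum : ∑ x, p x = 1)
    (q : Z → S → ℝ) (hq : ∀ z s, 0 < q z s) (hqsum : ∀ z, ∑ s, q z s = 1) :
    let pZ : Z → ℝ := fun z => ∑ s, p (z, s)
    let pS : S → ℝ := fun s => ∑ z, p (z, s)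
    let MI : ℝ := ∑ z, ∑ s, p (z, s) * Real.log (p (z, s) / (pZ z * pS s))
    let Ipred : ℝ := ∑ z, ∑ s, p (z, s) * Real.log (q z s)
    let HS : ℝ := -∑ s, pS s * Real.log (pS s)
    let KL : Z → ℝ := fun z =>
      ∑ s, (p (z, s) / pZ z) * Real.log ((p (z, s) / pZ z) / q z s)
    MI = Ipred + HS + ∑ z, pZ z * KL z ∧ Ipred + HS ≤ MI := by
  intro pZ pS MI Ipred HS KL
  have hZ : ∀ z (_ : S), 0 < pZ z := fun z s =>
    Finset.sum_pos (fun s _ => hp (z, s)) ⟨s, Finset.mem_univ s⟩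
  have hS : ∀ s (_ : Z), 0 < pS s := fun s z =>
    Finset.sum_pos (fun z _ => hp (z, s)) ⟨z, Finset.mem_univ z⟩
  have hHS : HS = ∑ z, ∑ s, -(p (z, s) * Real.log (pS s)) := by
    rw [Finset.sum_comm]
    simp only [HS, Finset.sum_neg_distrib, ← Finset.sum_mul, pS]
  have hKL : ∑ z, pZ z * KL z
      = ∑ z, ∑ s, p (z, s) * Real.log ((p (z, s) / pZ z) / q z s) := by
    refine Finset.sum_congr rfl fun z _ => ?_
    simp only [KL, Finset.mul_sum]
    refine Finset.sum_congr rfl fun s _ => ?_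
    have h := (hZ z s).ne'
    rw [← mul_assoc, mul_div_cancel₀ _ h]
  have hmain : MI = Ipred + HS + ∑ z, pZ z * KL z := by
    rw [hHS, hKL]
    simp only [MI, Ipred, ← Finset.sum_add_distrib]
    refine Finset.sum_congr rfl fun z _ => Finset.sum_congr rfl fun s _ => ?_
    have h1 := (hZ z s).ne'
    have h2 := (hS s z).ne'
    have h3 := (hp (z, s)).ne'
    have h4 := (hq z s).ne'
    rw [Real.log_div h3 (mul_ne_zero h1 h2), Real.log_mul h1 h2,
      Real.log_div (div_ne_zero h3 h1) h4, Real.log_div h3 h1]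
    ring
  have hnn : 0 ≤ ∑ z, pZ z * KL z := by
    rw [hKL]
    refine Finset.sum_nonneg fun z _ => ?_
    have hz : ∑ s, (p (z, s) - pZ z * q z s) = 0 := by
      rw [Finset.sum_sub_distrib, ← Finset.mul_sum, hqsum, mul_one]
      exact sub_self _
    rw [← hz]
    refine Finset.sum_le_sum fun s _ => ?_
    have h1 := hZ z s
    have h3 := hp (z, s)
    have h4 := hq z s
    have hl := Real.one_sub_inv_le_log_of_pos (div_pos (div_pos h3 h1) h4)
    have := mul_le_mul_of_nonneg_left hl h3.le
    refine le_trans (le_of_eq ?_) this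
    field_simp
  exact ⟨hmain, by linarith⟩
end

section
/- Let Z and S be finite types, let p be a strictly positive probability mass function on Z × S with marginals p_Z and p_S, and let N ≥ 1 be an integer. Consider a binary latent variable C with prior p(C=1) = 1/(N+1), p(C=0) = N/(N+1), and likelihoods p(z,s | C=1) = p(z,s) and p(z,s | C=0) = p_Z(z)·p_S(s). Then (i) the posterior satisfies p(C=1 | z,s) = p(z,s) / (N·p_Z(z)·p_S(s) + p(z,s)) for every (z,s); and (ii) ∑_{z,s} p(z,s) · log p(C=1 | z,s) ≤ I(Z;S) − log N, i.e., I(Z;S) ≥ log N + E_{p(z,s)}[log p(C=1 | z,s)]. -/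
open Finset

/-- Posterior of the binary latent `C` in the contrastive setup, and the resulting
lower bound `I(Z;S) ≥ log N + E_{p(z,s)}[log p(C=1|z,s)]`. -/
theorem contrastive_posterior_bound
    {Z S : Type*} [Fintype Z] [Fintype S]
    (p : Z × S → ℝ) (hp : ∀ x, 0 < p x) (hpsum : ∑ x, p x = 1)
    (N : ℕ) (hN : 1 ≤ N) :
    let pZ : Z → ℝ := fun z => ∑ s, p (z, s)
    let pS : S → ℝ := fun s => ∑ z, p (z, s)
    let MI : ℝ := ∑ z, ∑ s, p (z, s) * Real.log (p (z, s) / (pZ z * pS s))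
    -- posterior p(C=1|z,s) obtained from Bayes rule with prior p(C=1)=1/(N+1),
    -- p(C=0)=N/(N+1) and likelihoods p(z,s|C=1)=p(z,s), p(z,s|C=0)=pZ(z)·pS(s)
    let post : Z → S → ℝ := fun z s =>
      ((1 / ((N : ℝ) + 1)) * p (z, s)) /
        ((1 / ((N : ℝ) + 1)) * p (z, s) + ((N : ℝ) / ((N : ℝ) + 1)) * (pZ z * pS s))
    (∀ z s, post z s = p (z, s) / ((N : ℝ) * pZ z * pS s + p (z, s))) ∧
      (∑ z, ∑ s, p (z, s) * Real.log (post z s)) ≤ MI - Real.log N := by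
  intro pZ pS MI post
  have hN0 : (0 : ℝ) < N := by exact_mod_cast hN
  have hZ : ∀ z (_ : S), 0 < pZ z := fun z s =>
    Finset.sum_pos (fun s _ => hp (z, s)) ⟨s, Finset.mem_univ s⟩
  have hS : ∀ (_ : Z) s, 0 < pS s := fun z s =>
    Finset.sum_pos (fun z _ => hp (z, s)) ⟨z, Finset.mem_univ z⟩
  have h1 : ∀ z s, post z s = p (z, s) / ((N : ℝ) * pZ z * pS s + p (z, s)) := by
    intro z s
    have a := hp (z, s)
    have b := hZ z s
    have c := hS z s
    have e : (1 / ((N : ℝ) + 1)) * p (z, s) + ((N : ℝ) / ((N : ℝ) + 1)) * (pZ z * pS s)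
        = (1 / ((N : ℝ) + 1)) * ((N : ℝ) * pZ z * pS s + p (z, s)) := by ring
    have hne : (1 / ((N : ℝ) + 1)) ≠ 0 := by positivity
    change ((1 / ((N : ℝ) + 1)) * p (z, s)) /
        ((1 / ((N : ℝ) + 1)) * p (z, s) + ((N : ℝ) / ((N : ℝ) + 1)) * (pZ z * pS s)) = _
    rw [e, mul_div_mul_left _ _ hne]
  refine ⟨h1, ?_⟩
  have h2 : Real.log N = ∑ z, ∑ s, p (z, s) * Real.log N := by
    rw [← Fintype.sum_prod_type' (fun z s => p (z, s) * Real.log N), ← Finset.sum_mul, hpsum,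
      one_mul]
  rw [h2]
  simp only [MI]
  rw [← Finset.sum_sub_distrib]
  refine Finset.sum_le_sum fun z _ => ?_
  rw [← Finset.sum_sub_distrib]
  refine Finset.sum_le_sum fun s _ => ?_
  have a := hp (z, s)
  have b := hZ z s
  have c := hS z s
  rw [← mul_sub, h1, ← Real.log_div (by positivity) hN0.ne']
  refine mul_le_mul_of_nonneg_left (Real.log_le_log (by positivity) ?_) a.le
  rw [div_div]
  refine div_le_div_of_nonneg_left a.le (by positivity) ?_
  nlinarith
end

section
/- Let Z and S be finite types, let p be a strictly positive probability mass function on Z × S with marginals p_Z and p_S, let N ≥ 1 be an integer, and let h : Z → S → ℝ be any score function. Define the InfoNCE objective L_nce(h) = ∑_{(z,s)} p(z,s) · ∑_{(s_1,…,s_N) ∈ S^N} (∏_{j=1}^{N} p_S(s_j)) · log( exp(h(z,s)) / (exp(h(z,s)) + ∑_{j=1}^{N} exp(h(z,s_j))) ), where the inner sum is over all N-tuples of i.i.d. negative samples drawn from the marginal p_S. Then I(Z;S) ≥ log N + L_nce(h). -/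
open Finset

lemma nce_total {S : Type*} [Fintype S] (q : S → ℝ) (hq1 : ∑ s, q s = 1) (n : ℕ) :
    ∑ x : Fin n → S, ∏ j, q (x j) = 1 := by
  rw [← Fintype.sum_pow q n, hq1, one_pow]

lemma nce_sym {S : Type*} [Fintype S] (q e : S → ℝ) (he : ∀ s, 0 < e s)
    (hq1 : ∑ s, q s = 1) (N : ℕ) :
    ((N : ℝ) + 1) * ∑ s, q s * ∑ neg : Fin N → S, (∏ j, q (neg j)) *
      (e s / (e s + ∑ j, e (neg j))) = 1 := by
  set F : Fin (N + 1) → ℝ := fun i => ∑ x : Fin (N + 1) → S, (∏ j, q (x j)) *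
    (e (x i) / ∑ j, e (x j)) with hF
  have h0 : ∑ s, q s * ∑ neg : Fin N → S, (∏ j, q (neg j)) *
      (e s / (e s + ∑ j, e (neg j))) = F 0 := by
    simp only [hF]
    rw [← (Fin.consEquiv (fun _ : Fin (N + 1) => S)).sum_comp, Fintype.sum_prod_type]
    refine Finset.sum_congr rfl fun s _ => ?_
    rw [Finset.mul_sum]
    refine Finset.sum_congr rfl fun neg _ => ?_
    simp [Fin.consEquiv, Fin.prod_univ_succ, Fin.sum_univ_succ, mul_assoc]
  have hi : ∀ i, F i = F 0 := by
    intro i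
    simp only [hF]
    rw [← (Equiv.arrowCongr (Equiv.swap 0 i) (Equiv.refl S)).sum_comp]
    refine Finset.sum_congr rfl fun x _ => ?_
    have h1 : ∏ j, q (x (Equiv.swap 0 i j)) = ∏ j, q (x j) :=
      Equiv.prod_comp (Equiv.swap 0 i) fun j => q (x j)
    have h2 : ∑ j, e (x (Equiv.swap 0 i j)) = ∑ j, e (x j) :=
      Equiv.sum_comp (Equiv.swap 0 i) fun j => e (x j)
    simp [Equiv.arrowCongr, h1, h2]
  have hs : ∑ i, F i = 1 := by
    simp only [hF]
    rw [Finset.sum_comm, ← nce_total q hq1 (N + 1)]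
    refine Finset.sum_congr rfl fun x _ => ?_
    have : 0 < ∑ j, e (x j) := Finset.sum_pos (fun j _ => he _) ⟨0, Finset.mem_univ _⟩
    rw [← Finset.mul_sum, ← Finset.sum_div, div_self this.ne', mul_one]
  rw [Finset.sum_congr rfl fun i _ => hi i] at hs
  rw [h0]
  simpa using hs

lemma nce_pt {a b r c : ℝ} (ha : 0 < a) (hb : 0 < b) (hr : 0 < r) (hc : 0 < c) :
    a * (Real.log c + Real.log r - Real.log (a / b)) ≤ b * c * r - a := by
  have h1 : Real.log c + Real.log r - Real.log (a / b) = Real.log (b * c * r / a) := by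
    rw [Real.log_div ha.ne' hb.ne', Real.log_div (by positivity) ha.ne',
      Real.log_mul (by positivity) hr.ne', Real.log_mul hb.ne' hc.ne']
    ring
  rw [h1]
  have h2 := Real.log_le_sub_one_of_pos (show 0 < b * c * r / a by positivity)
  calc _ ≤ a * (b * c * r / a - 1) := by gcongr
    _ = _ := by field_simp

/-- The InfoNCE lower bound: for any score function `h` and `N ≥ 1` i.i.d. negative
samples drawn from the marginal `p_S`, `I(Z;S) ≥ log N + L_nce(h)`. -/
theorem infoNCE_lower_bound
    {Z S : Type*} [Fintype Z] [Fintype S]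
    (p : Z × S → ℝ) (hp : ∀ x, 0 < p x) (hpsum : ∑ x, p x = 1)
    (N : ℕ) (hN : 1 ≤ N) (h : Z → S → ℝ) :
    let pZ : Z → ℝ := fun z => ∑ s, p (z, s)
    let pS : S → ℝ := fun s => ∑ z, p (z, s)
    let MI : ℝ := ∑ z, ∑ s, p (z, s) * Real.log (p (z, s) / (pZ z * pS s))
    let Lnce : ℝ :=
      ∑ z, ∑ s, p (z, s) *
        ∑ neg : Fin N → S, (∏ j, pS (neg j)) *
          Real.log (Real.exp (h z s) /
            (Real.exp (h z s) + ∑ j, Real.exp (h z (neg j))))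
    Real.log N + Lnce ≤ MI := by
  intro pZ pS MI Lnce
  have hN0 : (0 : ℝ) < N := by exact_mod_cast hN
  have hpp : ∑ z, ∑ s, p (z, s) = 1 := by rw [← hpsum, Fintype.sum_prod_type]
  have hS1 : ∑ s, pS s = 1 := by
    rw [← hpp]; exact Finset.sum_comm
  have hSnn : ∀ s, 0 ≤ pS s := fun s => Finset.sum_nonneg fun z _ => (hp _).le
  have hw1 := nce_total pS hS1 N
  have key : ∀ z s, p (z, s) * (Real.log N + (∑ neg : Fin N → S, (∏ j, pS (neg j)) *
          Real.log (Real.exp (h z s) / (Real.exp (h z s) + ∑ j, Real.exp (h z (neg j)))))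
        - Real.log (p (z, s) / (pZ z * pS s))) ≤
      pZ z * N * (pS s * ∑ neg : Fin N → S, (∏ j, pS (neg j)) *
          (Real.exp (h z s) / (Real.exp (h z s) + ∑ j, Real.exp (h z (neg j))))) - p (z, s) := by
    intro z s
    have hz : 0 < pZ z := Finset.sum_pos (fun s _ => hp _) ⟨s, Finset.mem_univ _⟩
    have hs : 0 < pS s := Finset.sum_pos (fun z _ => hp _) ⟨z, Finset.mem_univ _⟩
    have hsum : ∑ neg : Fin N → S, (∏ j, pS (neg j)) * (p (z, s) * (Real.log N +
          Real.log (Real.exp (h z s) / (Real.exp (h z s) + ∑ j, Real.exp (h z (neg j))))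
          - Real.log (p (z, s) / (pZ z * pS s)))) ≤
        ∑ neg : Fin N → S, (∏ j, pS (neg j)) * ((pZ z * pS s) * N *
          (Real.exp (h z s) / (Real.exp (h z s) + ∑ j, Real.exp (h z (neg j)))) - p (z, s)) := by
      refine Finset.sum_le_sum fun neg _ => ?_
      refine mul_le_mul_of_nonneg_left ?_ (Finset.prod_nonneg fun j _ => hSnn _)
      have : 0 ≤ ∑ j, Real.exp (h z (neg j)) := Finset.sum_nonneg fun j _ => (Real.exp_pos _).le
      have := Real.exp_pos (h z s)
      exact nce_pt (hp _) (mul_pos hz hs) (by positivity) hN0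
    have e1 : ∀ (c d k : ℝ) (f : (Fin N → S) → ℝ), ∑ neg : Fin N → S, (∏ j, pS (neg j)) *
        (k * (c + f neg - d)) = k * (c + (∑ neg : Fin N → S, (∏ j, pS (neg j)) * f neg) - d) := by
      intro c d k f
      have : ∀ neg : Fin N → S, (∏ j, pS (neg j)) * (k * (c + f neg - d)) =
        (∏ j, pS (neg j)) * (k * (c - d)) + k * ((∏ j, pS (neg j)) * f neg) := fun _ => by ring
      simp only [this]
      rw [Finset.sum_add_distrib, ← Finset.sum_mul, ← Finset.mul_sum, hw1]
      ring
    have e2 : ∀ (d k : ℝ) (f : (Fin N → S) → ℝ), ∑ neg : Fin N → S, (∏ j, pS (neg j)) *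
        (k * f neg - d) = k * (∑ neg : Fin N → S, (∏ j, pS (neg j)) * f neg) - d := by
      intro d k f
      have : ∀ neg : Fin N → S, (∏ j, pS (neg j)) * (k * f neg - d) =
        k * ((∏ j, pS (neg j)) * f neg) - (∏ j, pS (neg j)) * d := fun _ => by ring
      simp only [this]
      rw [Finset.sum_sub_distrib, ← Finset.sum_mul, ← Finset.mul_sum, hw1]
      ring
    rw [e1, e2] at hsum
    refine hsum.trans (le_of_eq ?_)
    ring
  have tot := Finset.sum_le_sum fun z (_ : z ∈ (Finset.univ : Finset Z)) =>
    Finset.sum_le_sum fun s (_ : s ∈ (Finset.univ : Finset S)) => key z s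
  simp only [mul_sub, mul_add, Finset.sum_sub_distrib, Finset.sum_add_distrib,
    ← Finset.sum_mul] at tot
  rw [hpp, one_mul] at tot
  have rhs : ∑ z, ∑ s, pZ z * N * (pS s * ∑ neg : Fin N → S, (∏ j, pS (neg j)) *
      (Real.exp (h z s) / (Real.exp (h z s) + ∑ j, Real.exp (h z (neg j))))) ≤ 1 := by
    rw [← hpp]
    refine Finset.sum_le_sum fun z _ => ?_
    rw [← Finset.mul_sum]
    have hz : 0 ≤ pZ z := Finset.sum_nonneg fun s _ => (hp _).le
    have hsy := nce_sym pS (fun s => Real.exp (h z s)) (fun s => Real.exp_pos _) hS1 N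
    set A := ∑ s, pS s * ∑ neg : Fin N → S, (∏ j, pS (neg j)) *
      (Real.exp (h z s) / (Real.exp (h z s) + ∑ j, Real.exp (h z (neg j))))
    have hA : 0 ≤ A := by
      by_contra hA
      nlinarith
    have : N * A ≤ 1 := by linarith
    calc pZ z * N * A = pZ z * (N * A) := by ring
      _ ≤ pZ z * 1 := by gcongr
      _ = _ := by simp [pZ]
  show Real.log N + Lnce ≤ MI
  simp only [Lnce, MI]
  linarith
end

section
/- Let c, d be positive integers, λ > 0, and η_0, …, η_m, η ∈ ℝ^d. Let Λ = ∑_{i=0}^{m} η_i η_iᵀ + λ I_d, let Λ̃ be the block diagonal matrix with c copies of Λ, and let η̃ be the block matrix with η in each of the c diagonal blocks. Then Λ̃ and Λ̃ + η̃ η̃ᵀ are positive definite, and (1/2)·log det(Λ̃ + η̃ η̃ᵀ) − (1/2)·log det(Λ̃) = (c/2) · log(1 + ηᵀ Λ⁻¹ η). (This identity shows that the information gain of the Bayesian linear regression, expressed as half the difference of log-determinants of posterior precision matrices before and after observing the new transition, equals (c/2)·log(1 + ηᵀΛ⁻¹η).) -/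
open Matrix Finset

lemma aux_block_eq (c d : ℕ) (M : Matrix (Fin d) (Fin d) ℝ) :
    (fun p q => if p.1 = q.1 then M p.2 q.2 else 0 :
      Matrix (Fin c × Fin d) (Fin c × Fin d) ℝ) =
      kroneckerMap (· * ·) (1 : Matrix (Fin c) (Fin c) ℝ) M := by
  ext p q
  simp [kroneckerMap_apply, Matrix.one_apply]

/-- Information gain as a log-determinant difference: `Λ̃` and `Λ̃ + η̃η̃ᵀ` are positive
definite, and `(1/2)·log det(Λ̃ + η̃η̃ᵀ) − (1/2)·log det(Λ̃) = (c/2)·log(1 + ηᵀΛ⁻¹η)`. -/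
theorem info_gain_logdet (c d : ℕ) (hc : 0 < c) (hd : 0 < d) (m : ℕ)
    (lam : ℝ) (hlam : 0 < lam) (ηs : Fin (m + 1) → Fin d → ℝ) (η : Fin d → ℝ) :
    let Λ : Matrix (Fin d) (Fin d) ℝ := (∑ i, vecMulVec (ηs i) (ηs i)) + lam • 1
    let Λt : Matrix (Fin c × Fin d) (Fin c × Fin d) ℝ :=
      fun p q => if p.1 = q.1 then Λ p.2 q.2 else 0
    let ηt : Matrix (Fin c × Fin d) (Fin c) ℝ :=
      fun p j => if p.1 = j then η p.2 else 0
    Λt.PosDef ∧ (Λt + ηt * ηtᵀ).PosDef ∧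
      (1 / 2) * Real.log (Λt + ηt * ηtᵀ).det - (1 / 2) * Real.log Λt.det =
        ((c : ℝ) / 2) * Real.log (1 + η ⬝ᵥ (Λ⁻¹ *ᵥ η)) := by
  intro Λ Λt ηt
  have hv : ∀ v : Fin d → ℝ, (vecMulVec v v).PosSemidef := fun v => by
    simpa using posSemidef_vecMulVec_self_star v
  have hΛ : Λ.PosDef :=
    Matrix.PosDef.posSemidef_add (posSemidef_sum _ fun i _ => hv (ηs i))
      (Matrix.PosDef.one.smul hlam)
  have hN : (Λ + vecMulVec η η).PosDef := hΛ.add_posSemidef (hv η)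
  have e1 : Λt = kroneckerMap (· * ·) (1 : Matrix (Fin c) (Fin c) ℝ) Λ := aux_block_eq c d Λ
  have e2 : Λt + ηt * ηtᵀ =
      kroneckerMap (· * ·) (1 : Matrix (Fin c) (Fin c) ℝ) (Λ + vecMulVec η η) := by
    rw [← aux_block_eq]
    ext p q
    rw [Matrix.add_apply, Matrix.mul_apply]
    simp only [Matrix.transpose_apply, Matrix.add_apply, vecMulVec_apply]
    simp only [Λt, ηt]
    by_cases h : p.1 = q.1
    · simp [h]
    · simp [h, Ne.symm h]
  have hdet : (Λ + vecMulVec η η).det = Λ.det * (1 + η ⬝ᵥ (Λ⁻¹ *ᵥ η)) := by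
    rw [vecMulVec_eq Unit, det_add_replicateCol_mul_replicateRow hΛ.det_pos.ne'.isUnit]
    congr 1
    rw [Matrix.mul_assoc, ← replicateCol_mulVec]
    simp [Matrix.det_unique, Matrix.mul_apply, dotProduct]
  have hpos : 0 < 1 + η ⬝ᵥ (Λ⁻¹ *ᵥ η) := by
    have := hN.det_pos
    rw [hdet] at this
    exact (pos_iff_pos_of_mul_pos this).1 hΛ.det_pos
  refine ⟨?_, ?_, ?_⟩
  · rw [e1]; exact Matrix.PosDef.one.kronecker hΛ
  · rw [e2]; exact Matrix.PosDef.one.kronecker hN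
  · rw [e2, e1, det_kronecker, det_kronecker, hdet]
    simp only [det_one, one_pow, one_mul, Fintype.card_fin, Real.log_pow]
    rw [Real.log_mul hΛ.det_pos.ne' hpos.ne']
    ring
end
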